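/- Let α, β, γ > 0, δ ≥ 0, K, P, E > 0, T > 0 and ε > 0. Let (u_ε, σ_ε, p_ε) be a smooth, ℤ³-periodic-in-space solution on ℝ³×[0,T] of the diffusive regularized Oldroyd-B system ∂ₜu_ε = αΔu_ε − (Ju_ε·∇)u_ε + β div(Jσ_ε) − β∇p_ε + β𝓕, ∂ₜσ_ε = εΔσ_ε − (Ju_ε·∇)σ_ε + (∇Ju_ε)σ_ε + σ_ε(∇Ju_ε)ᵀ − γσ_ε + δI, and let (u, σ, p) be a smooth, ℤ³-periodic-in-space solution of the same system with ε replaced by 0, with the same forcing 𝓕 and the same initial data u_ε(·,0) = u(·,0), σ_ε(·,0) = σ(·,0); assume ∇·u_ε = ∇·u = 0. Assume: (i) for every ℤ³-periodic scalar f and every x, |Jf(x)| + |(∇Jf)(x)| ≤ K‖f‖_{L²}; (ii) ∫₀ᵀ ‖∇u_ε(·,s)‖²_{L²} ds ≤ E; (iii) ‖∇u_ε(·,t)‖²_{L²} ≤ P, ‖σ(·,t)‖²_{L²} ≤ P, ‖∇σ(·,t)‖²_{L²} ≤ P and ‖Δσ(·,t)‖²_{L²} ≤ P for all t ∈ [0,T].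 Then there exists a constant C, depending only on β, γ, δ, K, P, E and T, such that for all t ∈ [0,T]: ‖u_ε(·,t) − u(·,t)‖²_{L²} + ‖σ_ε(·,t) − σ(·,t)‖²_{L²} ≤ ε C. In particular, the left-hand side tends to 0 uniformly on [0,T] as ε → 0. -/

import Mathlib

open MeasureTheory

noncomputable section

abbrev V3 := Fin 3 → ℝ

/-- spatial partial derivative ∂ᵢf -/
def pd (i : Fin 3) (f : V3 → ℝ) (x : V3) : ℝ := fderiv ℝ f x (Pi.single i 1)

/-- Laplacian of a scalar function -/
def lap (f : V3 → ℝ) (x : V3) : ℝ := ∑ i, pd i (pd i f) x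

/-- ℤ³-periodicity -/
def Periodic3 (f : V3 → ℝ) : Prop :=
  ∀ (x : V3) (k : Fin 3 → ℤ), f (x + fun i => (k i : ℝ)) = f x

/-- mollification Jf = η ∗ f -/
def J3 (η f : V3 → ℝ) (x : V3) : ℝ := ∫ y, η (x - y) * f y

/-- curl ∇×u -/
def curl3 (u : V3 → V3) (x : V3) : V3 :=
  ![pd 1 (fun y => u y 2) x - pd 2 (fun y => u y 1) x,
    pd 2 (fun y => u y 0) x - pd 0 (fun y => u y 2) x,
    pd 0 (fun y => u y 1) x - pd 1 (fun y => u y 0) x]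

/-- (v·∇)u -/
def advect (v u : V3 → V3) (x : V3) : V3 :=
  fun i => ∑ j, v x j * pd j (fun y => u y i) x

/-- the bilinear term Ω(v,u) -/
def Omg (v u : V3 → V3) (x : V3) : V3 :=
  ![∑ j, (pd 1 (fun y => v y j) x * pd j (fun y => u y 2) x
      - pd 2 (fun y => v y j) x * pd j (fun y => u y 1) x),
    ∑ j, (pd 2 (fun y => v y j) x * pd j (fun y => u y 0) x
      - pd 0 (fun y => v y j) x * pd j (fun y => u y 2) x),
    ∑ j, (pd 0 (fun y => v y j) x * pd j (fun y => u y 1) x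
      - pd 1 (fun y => v y j) x * pd j (fun y => u y 0) x)]

/-- `(u, σ, p)` is a smooth, ℤ³-periodic-in-space solution on ℝ³×[0,T] of the
regularized Oldroyd-B system with diffusivity ε and forcing 𝓕:
  ∂ₜu = αΔu − (Ju·∇)u + β div(Jσ) − β∇p + β𝓕,
  ∂ₜσ = εΔσ − (Ju·∇)σ + (∇Ju)σ + σ(∇Ju)ᵀ − γσ + δI. -/
def IsOBSolution (η : V3 → ℝ) (α β γ δ ε T : ℝ) (F : V3 → ℝ → V3)
    (u : V3 → ℝ → V3) (σ : V3 → ℝ → Matrix (Fin 3) (Fin 3) ℝ)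
    (p : V3 → ℝ → ℝ) : Prop :=
  (∀ i, ContDiff ℝ (⊤:ℕ∞) (fun q : V3 × ℝ => u q.1 q.2 i)) ∧
  (∀ i j, ContDiff ℝ (⊤:ℕ∞) (fun q : V3 × ℝ => σ q.1 q.2 i j)) ∧
  ContDiff ℝ (⊤:ℕ∞) (fun q : V3 × ℝ => p q.1 q.2) ∧
  (∀ t i, Periodic3 (fun x => u x t i)) ∧
  (∀ t i j, Periodic3 (fun x => σ x t i j)) ∧
  (∀ t, Periodic3 (fun x => p x t)) ∧
  (∀ x : V3, ∀ t ∈ Set.Icc (0:ℝ) T, ∀ i,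
    HasDerivWithinAt (fun s => u x s i)
      (α * lap (fun y => u y t i) x
        - (∑ j, J3 η (fun z => u z t j) x * pd j (fun y => u y t i) x)
        + β * (∑ j, pd j (J3 η (fun z => σ z t i j)) x)
        - β * pd i (fun y => p y t) x
        + β * F x t i)
      (Set.Icc (0:ℝ) T) t) ∧
  (∀ x : V3, ∀ t ∈ Set.Icc (0:ℝ) T, ∀ i j,
    HasDerivWithinAt (fun s => σ x s i j)
      (ε * lap (fun y => σ y t i j) x
        - (∑ k, J3 η (fun z => u z t k) x * pd k (fun y => σ y t i j) x)
        + (∑ k, pd k (J3 η (fun z => u z t i)) x * σ x t k j)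
        + (∑ k, σ x t i k * pd k (J3 η (fun z => u z t j)) x)
        - γ * σ x t i j
        + δ * (if i = j then (1:ℝ) else 0))
      (Set.Icc (0:ℝ) T) t)

/-- Smooth ℤ³-periodic functions. -/
structure SmoothPeriodic (f : V3 → ℝ) : Prop where
  smooth : ContDiff ℝ (⊤:ℕ∞) f
  periodic : Periodic3 f

lemma contDiff_pd {f : V3 → ℝ} (hf : ContDiff ℝ (⊤:ℕ∞) f) (i : Fin 3) :
    ContDiff ℝ (⊤:ℕ∞) (pd i f) :=
  (hf.fderiv_right (m := (⊤:ℕ∞)) (by simp)).clm_apply contDiff_const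

lemma pd_add {f g : V3 → ℝ} (hf : Differentiable ℝ f) (hg : Differentiable ℝ g) (i : Fin 3)
    (x : V3) : pd i (fun y => f y + g y) x = pd i f x + pd i g x := by
  simp [pd, fderiv_fun_add (hf x) (hg x)]

lemma pd_sub {f g : V3 → ℝ} (hf : Differentiable ℝ f) (hg : Differentiable ℝ g) (i : Fin 3)
    (x : V3) : pd i (fun y => f y - g y) x = pd i f x - pd i g x := by
  simp [pd, fderiv_fun_sub (hf x) (hg x)]

lemma pd_mul {f g : V3 → ℝ} (hf : Differentiable ℝ f) (hg : Differentiable ℝ g) (i : Fin 3)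
    (x : V3) : pd i (fun y => f y * g y) x = f x * pd i g x + pd i f x * g x := by
  simp [pd, fderiv_fun_mul (hf x) (hg x)]; ring

namespace SmoothPeriodic

variable {f g : V3 → ℝ}

lemma differentiable (hf : SmoothPeriodic f) : Differentiable ℝ f :=
  hf.smooth.differentiable (by simp)

lemma continuous (hf : SmoothPeriodic f) : Continuous f := hf.smooth.continuous

lemma add (hf : SmoothPeriodic f) (hg : SmoothPeriodic g) :
    SmoothPeriodic (fun x => f x + g x) :=
  ⟨hf.smooth.add hg.smooth, fun x k => by
    have h₁ := hf.periodic x k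
    have h₂ := hg.periodic x k
    simp only [h₁, h₂]⟩

lemma sub (hf : SmoothPeriodic f) (hg : SmoothPeriodic g) :
    SmoothPeriodic (fun x => f x - g x) :=
  ⟨hf.smooth.sub hg.smooth, fun x k => by
    have h₁ := hf.periodic x k
    have h₂ := hg.periodic x k
    simp only [h₁, h₂]⟩

lemma mul (hf : SmoothPeriodic f) (hg : SmoothPeriodic g) :
    SmoothPeriodic (fun x => f x * g x) :=
  ⟨hf.smooth.mul hg.smooth, fun x k => by
    have h₁ := hf.periodic x k
    have h₂ := hg.periodic x k
    simp only [h₁, h₂]⟩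

protected lemma pd (hf : SmoothPeriodic f) (i : Fin 3) : SmoothPeriodic (pd i f) := by
  refine ⟨contDiff_pd hf.smooth i, fun x k => ?_⟩
  have h : (fun y => f (y + fun i => (k i : ℝ))) = f := funext fun y => hf.periodic y k
  have := fderiv_comp_add_right (𝕜 := ℝ) (f := f) (x := x) (fun i => (k i : ℝ))
  rw [h] at this
  simp [pd, this]

lemma continuous_pd (hf : SmoothPeriodic f) (i : Fin 3) : Continuous (_root_.pd i f) :=
  (hf.pd i).continuous

lemma continuous_lap (hf : SmoothPeriodic f) : Continuous (lap f) :=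
  continuous_finsetSum _ fun i _ => ((hf.pd i).pd i).continuous

lemma integral_pd (hf : SmoothPeriodic f) (i : Fin 3) :
    ∫ x in Set.Icc (0:V3) 1, _root_.pd i f x = 0 := by
  have h := integral_divergence_of_hasFDerivAt_off_countable' (0:V3) 1 zero_le_one
    (fun j => if j = i then f else 0) (fun j => if j = i then fderiv ℝ f else 0) ∅
    Set.countable_empty
    (fun j => by
      by_cases hj : j = i
      · simpa [hj] using hf.continuous.continuousOn
      · rw [if_neg hj]
        exact continuousOn_const)
    (fun x _ j => by
      by_cases hj : j = i
      · simpa [hj] using (hf.differentiable x).hasFDerivAt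
      · rw [if_neg hj, if_neg hj]
        exact hasFDerivAt_const (0:ℝ) x)
    (by
      have hc : Continuous (_root_.pd i f) := hf.continuous_pd i
      refine Continuous.integrableOn_Icc ?_
      refine continuous_finsetSum _ fun j _ => ?_
      by_cases hj : j = i
      · subst hj
        simp only [if_true]
        exact hc
      · simpa [hj] using continuous_const)
  have e : ∀ x : V3, ∑ j, (if j = i then fderiv ℝ f else 0) x (Pi.single j 1)
      = _root_.pd i f x := fun x => by
    rw [Finset.sum_eq_single i] <;> simp +contextual [_root_.pd]
  simp only [e] at h
  rw [h]
  refine Finset.sum_eq_zero fun j _ => ?_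
  by_cases hj : j = i
  · subst hj
    rw [sub_eq_zero]
    refine integral_congr_ae (Filter.Eventually.of_forall fun x => ?_)
    have := hf.periodic (j.insertNth 0 x) (Pi.single j 1)
    simp only [if_true, Pi.zero_apply, Pi.one_apply]
    rw [← this]
    congr 1
    funext l
    rcases Fin.eq_self_or_eq_succAbove j l with rfl | ⟨m, rfl⟩
    · simp
    · simp
  · simp [hj]

end SmoothPeriodic

lemma integrable_mollifier_mul {η f : V3 → ℝ} (hη : Continuous η) (hs : HasCompactSupport η)
    (hf : Continuous f) (x : V3) : Integrable (fun y => η (x - y) * f y) := by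
  refine Continuous.integrable_of_hasCompactSupport (by fun_prop) ?_
  exact HasCompactSupport.mul_right (hs.comp_homeomorph (Homeomorph.subLeft x))

lemma J3_sub {η f g : V3 → ℝ} (hη : Continuous η) (hs : HasCompactSupport η)
    (hf : Continuous f) (hg : Continuous g) (x : V3) :
    J3 η (fun y => f y - g y) x = J3 η f x - J3 η g x := by
  simp only [J3, mul_sub]
  exact integral_sub (integrable_mollifier_mul hη hs hf x) (integrable_mollifier_mul hη hs hg x)

lemma J3_sum {η : V3 → ℝ} {f : Fin 3 → V3 → ℝ} (hη : Continuous η) (hs : HasCompactSupport η)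
    (hf : ∀ i, Continuous (f i)) (x : V3) :
    J3 η (fun y => ∑ i, f i y) x = ∑ i, J3 η (f i) x := by
  simp only [J3, Finset.mul_sum]
  exact integral_finsetSum _ fun i _ => integrable_mollifier_mul hη hs (hf i) x

lemma J3_eq_convolution (η f : V3 → ℝ) :
    J3 η f = MeasureTheory.convolution f η (ContinuousLinearMap.mul ℝ ℝ) volume := by
  funext x
  simp [J3, convolution_def, mul_comm]

lemma pd_J3 {η f : V3 → ℝ} (hη : ContDiff ℝ (⊤:ℕ∞) η) (hs : HasCompactSupport η)
    (hf : ContDiff ℝ (⊤:ℕ∞) f) (i : Fin 3) (x : V3) :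
    pd i (J3 η f) x = J3 η (pd i f) x := by
  have hd : ∀ y, pd i (fun z => η (x - z)) y = - pd i η (x - y) := fun y => by
    have h := ((hη.differentiable (by simp) (x - y)).hasFDerivAt).comp y
      ((hasFDerivAt_id y).const_sub x)
    change fderiv ℝ (η ∘ HSub.hSub x) y _ = _
    rw [h.fderiv]
    simp [pd]
  have hc := hs.hasFDerivAt_convolution_right (ContinuousLinearMap.mul ℝ ℝ) (μ := volume)
    (f := f) hf.continuous.locallyIntegrable (hη.of_le (by simp)) x
  have hpη : Continuous (pd i η) := (contDiff_pd hη i).continuous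
  have hpf : Continuous (pd i f) := (contDiff_pd hf i).continuous
  have hsη : HasCompactSupport (pd i η) := by
    refine (hs.fderiv (𝕜 := ℝ)).comp_left (g := fun L : V3 →L[ℝ] ℝ => L (Pi.single i 1)) ?_
    simp
  have h₁ : pd i (J3 η f) x = J3 (pd i η) f x := by
    rw [J3_eq_convolution, pd, hc.fderiv, convolution_precompR_apply]
    · rw [J3_eq_convolution]; rfl
    · exact hf.continuous.locallyIntegrable
    · exact hs.fderiv (𝕜 := ℝ)
    · exact hη.continuous_fderiv (by simp)
  rw [h₁]
  have key := integral_mul_fderiv_eq_neg_fderiv_mul_of_integrable (μ := (volume : Measure V3))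
    (f := fun y => η (x - y)) (g := f) (v := (Pi.single i 1 : V3)) ?_ ?_ ?_ ?_ ?_
  · simp only [J3]
    change ∫ y, η (x - y) * pd i f y = - ∫ y, pd i (fun z => η (x - z)) y * f y at key
    rw [key, ← integral_neg]
    simp [hd]
  · change Integrable fun y => pd i (fun z => η (x - z)) y * f y
    simp only [hd, neg_mul]
    exact (integrable_mollifier_mul hpη hsη hf.continuous x).neg
  · exact integrable_mollifier_mul hη.continuous hs hpf x
  · exact integrable_mollifier_mul hη.continuous hs hf.continuous x
  · exact fun y _ => (hη.differentiable (by simp)).comp (by fun_prop : Differentiable ℝ fun y : V3 => x - y) y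
  · exact fun y _ => hf.differentiable (by simp) y

lemma SmoothPeriodic.mollify {η f : V3 → ℝ} (hη : ContDiff ℝ (⊤:ℕ∞) η)
    (hs : HasCompactSupport η) (hf : SmoothPeriodic f) : SmoothPeriodic (J3 η f) := by
  constructor
  · rw [J3_eq_convolution]
    exact hs.contDiff_convolution_right _ hf.continuous.locallyIntegrable hη
  · intro x k
    simp only [J3]
    rw [← integral_add_right_eq_self _ (fun i => (k i : ℝ))]
    refine integral_congr_ae (Filter.Eventually.of_forall fun y => ?_)
    have := hf.periodic y k
    simp only [this, add_sub_add_right_eq_sub]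

lemma hasDerivAt_integral_cube {g : V3 × ℝ → ℝ} (hg : ContDiff ℝ (⊤:ℕ∞) g) (t : ℝ) :
    HasDerivAt (fun s => ∫ x in Set.Icc (0:V3) 1, g (x, s))
      (∫ x in Set.Icc (0:V3) 1, deriv (fun s => g (x, s)) t) t := by
  have hd : ∀ x s, HasDerivAt (fun s => g (x, s)) (fderiv ℝ g (x, s) (0, 1)) s := fun x s => by
    have h := (hg.differentiable (by simp) (x, s)).hasFDerivAt.comp_hasDerivAt s
      ((hasDerivAt_const s x).prodMk (hasDerivAt_id s))
    exact h
  have hc : Continuous fun q : V3 × ℝ => fderiv ℝ g q (0, 1) :=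
    (hg.continuous_fderiv (by simp)).clm_apply continuous_const
  obtain ⟨M, hM⟩ := (isCompact_Icc (a := (0:V3)) (b := 1)).prod
    (isCompact_Icc (a := t - 1) (b := t + 1)) |>.exists_bound_of_continuousOn hc.continuousOn
  have h := hasDerivAt_integral_of_dominated_loc_of_deriv_le (𝕜 := ℝ)
    (μ := volume.restrict (Set.Icc (0:V3) 1)) (F := fun s x => g (x, s)) (x₀ := t)
    (s := Set.Icc (t - 1) (t + 1)) (F' := fun s x => fderiv ℝ g (x, s) (0, 1))
    (bound := fun _ => M) (Icc_mem_nhds (by linarith) (by linarith))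
    (Filter.Eventually.of_forall fun s =>
      (hg.continuous.comp (by fun_prop : Continuous fun x : V3 => (x, s))).aestronglyMeasurable)
    (Continuous.integrableOn_Icc
      (hg.continuous.comp (by fun_prop : Continuous fun x : V3 => (x, t))))
    (hc.comp (by fun_prop : Continuous fun x : V3 => (x, t))).aestronglyMeasurable
    ((ae_restrict_iff' measurableSet_Icc).2 (Filter.Eventually.of_forall
      fun x hx s hs => hM (x, s) ⟨hx, hs⟩))
    (Continuous.integrableOn_Icc continuous_const)
    (Filter.Eventually.of_forall fun x s _ => hd x s)
  simpa only [(hd _ t).deriv] using h.2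

lemma integral_transport {v : Fin 3 → V3 → ℝ} {f : V3 → ℝ} (hv : ∀ j, SmoothPeriodic (v j))
    (hdiv : ∀ x, ∑ j, pd j (v j) x = 0) (hf : SmoothPeriodic f) :
    ∫ x in Set.Icc (0:V3) 1, (∑ j, v j x * pd j f x) * f x = 0 := by
  have h : ∀ j, SmoothPeriodic (fun x => v j x * (f x * f x)) := fun j => (hv j).mul (hf.mul hf)
  have e : ∀ x, (∑ j, v j x * pd j f x) * f x
      = 2⁻¹ * ∑ j, pd j (fun x => v j x * (f x * f x)) x := fun x => by
    have hx := hdiv x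
    have h₂ : ∀ j, pd j (fun x => v j x * (f x * f x)) x
        = 2 * (v j x * pd j f x * f x) + pd j (v j) x * (f x * f x) := fun j => by
      rw [pd_mul (hv j).differentiable (hf.mul hf).differentiable,
        pd_mul hf.differentiable hf.differentiable]
      ring
    simp only [h₂, Finset.sum_add_distrib, ← Finset.sum_mul, ← Finset.mul_sum, hx]
    ring
  simp only [e]
  rw [integral_const_mul, integral_finsetSum _ fun j _ =>
    ((h j).continuous_pd j).integrableOn_Icc]
  simp [(h _).integral_pd]

lemma integral_pressure {w : Fin 3 → V3 → ℝ} {q : V3 → ℝ} (hw : ∀ i, SmoothPeriodic (w i))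
    (hdiv : ∀ x, ∑ i, pd i (w i) x = 0) (hq : SmoothPeriodic q) :
    ∫ x in Set.Icc (0:V3) 1, ∑ i, pd i q x * w i x = 0 := by
  have h : ∀ i, SmoothPeriodic (fun x => q x * w i x) := fun i => hq.mul (hw i)
  have e : ∀ x, ∑ i, pd i q x * w i x = ∑ i, pd i (fun x => q x * w i x) x := fun x => by
    have hx := hdiv x
    simp only [pd_mul hq.differentiable (hw _).differentiable, Finset.sum_add_distrib,
      ← Finset.mul_sum, hx]
    ring
  simp only [e]
  rw [integral_finsetSum _ fun i _ => ((h i).continuous_pd i).integrableOn_Icc]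
  simp [(h _).integral_pd]

lemma integral_lap_mul {f g : V3 → ℝ} (hf : SmoothPeriodic f) (hg : SmoothPeriodic g) :
    ∫ x in Set.Icc (0:V3) 1, lap f x * g x
      = - ∫ x in Set.Icc (0:V3) 1, ∑ j, pd j f x * pd j g x := by
  have h : ∀ j, SmoothPeriodic (fun x => pd j f x * g x) := fun j => (hf.pd j).mul hg
  have hc : Continuous fun x => ∑ j, pd j f x * pd j g x :=
    continuous_finsetSum _ fun j _ => (hf.continuous_pd j).mul (hg.continuous_pd j)
  have e : ∀ x, lap f x * g x
      = (∑ j, pd j (fun x => pd j f x * g x) x) - ∑ j, pd j f x * pd j g x := fun x => by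
    simp only [pd_mul (hf.pd _).differentiable hg.differentiable, Finset.sum_add_distrib,
      lap, Finset.sum_mul]
    ring
  simp only [e]
  rw [integral_sub (continuous_finsetSum _ fun j _ => (h j).continuous_pd j).integrableOn_Icc
    hc.integrableOn_Icc, integral_finsetSum _ fun j _ => ((h j).continuous_pd j).integrableOn_Icc]
  simp [(h _).integral_pd]

lemma abs_mul_mul_le_of_abs_le {b r s K A : ℝ} (hK : 0 ≤ K) (hA : 0 ≤ A)
    (hb : |b| ≤ K * √A) : |b * r * s| ≤ K / 2 * (A * r ^ 2 + s ^ 2) := by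
  have h₁ : |b * r * s| ≤ K * √A * (|r| * |s|) := by
    rw [abs_mul, abs_mul, mul_assoc]
    gcongr
  have h₂ : √A * |r| * |s| ≤ 1 / 2 * (A * r ^ 2 + s ^ 2) := by
    nlinarith [sq_nonneg (√A * |r| - |s|), Real.sq_sqrt hA, sq_abs r, sq_abs s]
  nlinarith

lemma volume_real_cube : volume.real (Set.Icc (0:V3) 1) = 1 := by
  simp [Measure.real, Real.volume_Icc_pi]

lemma velocity_energy_le {α β K P W N : ℝ} (hα : 0 ≤ α) (hβ : 0 ≤ β) (hK : 0 ≤ K)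
    (hN : 0 ≤ N) {w v b s : Fin 3 → V3 → ℝ} {q : V3 → ℝ} {a : Fin 3 → Fin 3 → V3 → ℝ}
    (hw : ∀ i, SmoothPeriodic (w i)) (hwdiv : ∀ x, ∑ i, pd i (w i) x = 0)
    (hv : ∀ i, SmoothPeriodic (v i)) (hvdiv : ∀ x, ∑ i, pd i (v i) x = 0)
    (hq : SmoothPeriodic q) (ha : ∀ i j, Continuous (a i j))
    (haP : ∫ x in Set.Icc (0:V3) 1, ∑ i, ∑ j, (a i j x) ^ 2 ≤ P)
    (hW : ∫ x in Set.Icc (0:V3) 1, ∑ i, (w i x) ^ 2 = W)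
    (hb : ∀ j x, |b j x| ≤ K * √W) (hs : ∀ i x, |s i x| ≤ 3 * K * √N)
    (hbc : ∀ j, Continuous (b j)) (hsc : ∀ j, Continuous (s j)) :
    ∫ x in Set.Icc (0:V3) 1, ∑ i, w i x * (α * lap (w i) x - (∑ j, v j x * pd j (w i) x)
        - (∑ j, b j x * a i j x) + β * s i x - β * pd i q x)
      ≤ K / 2 * (P * W + 3 * W) + β * (3 * K / 2) * (3 * N + W) := by
  have hW0 : 0 ≤ W := by rw [← hW]; positivity
  have cw : ∀ i, Continuous (w i) := fun i => (hw i).continuous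
  have cv : ∀ i, Continuous (v i) := fun i => (hv i).continuous
  have cpw : ∀ i j, Continuous (pd j (w i)) := fun i j => (hw i).continuous_pd j
  have clw : ∀ i, Continuous (lap (w i)) := fun i => (hw i).continuous_lap
  have cq : ∀ i, Continuous (pd i q) := fun i => hq.continuous_pd i
  have hlap : ∀ i, ∫ x in Set.Icc (0:V3) 1, lap (w i) x * w i x ≤ 0 := fun i => by
    rw [integral_lap_mul (hw i) (hw i), neg_nonpos]
    exact integral_nonneg fun x => Finset.sum_nonneg fun j _ => mul_self_nonneg _
  have htr : ∀ i, ∫ x in Set.Icc (0:V3) 1, (∑ j, v j x * pd j (w i) x) * w i x = 0 :=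
    fun i => integral_transport hv hvdiv (hw i)
  have hpr := integral_pressure hw hwdiv hq
  calc _ ≤ ∫ x in Set.Icc (0:V3) 1, (((α * ∑ i, lap (w i) x * w i x)
          - ∑ i, (∑ j, v j x * pd j (w i) x) * w i x) - β * ∑ i, pd i q x * w i x)
          + (K / 2 * (W * (∑ i, ∑ j, (a i j x) ^ 2) + 3 * ∑ i, (w i x) ^ 2)
            + β * (3 * K / 2) * (3 * N + ∑ i, (w i x) ^ 2)) := by
        refine integral_mono (Continuous.integrableOn_Icc (by fun_prop))
          (Continuous.integrableOn_Icc (by fun_prop)) fun x => ?_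
        have h₁ : ∀ i j, -(K / 2 * (W * (a i j x) ^ 2 + (w i x) ^ 2))
            ≤ b j x * a i j x * w i x := fun i j =>
          neg_le_of_abs_le (abs_mul_mul_le_of_abs_le hK hW0 (hb j x))
        have h₂ : ∀ i, β * (s i x * w i x) ≤ β * (3 * K / 2 * (N + (w i x) ^ 2)) := fun i => by
          have := le_of_abs_le (abs_mul_mul_le_of_abs_le (r := 1) (s := w i x)
            (by positivity) hN (hs i x))
          simp only [mul_one, one_pow] at this
          gcongr
        have h₃ := Finset.sum_le_sum fun i (_ : i ∈ Finset.univ) =>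
          Finset.sum_le_sum fun j (_ : j ∈ Finset.univ) => h₁ i j
        have h₄ := Finset.sum_le_sum fun i (_ : i ∈ Finset.univ) => h₂ i
        simp only [Fin.sum_univ_three] at h₃ h₄ ⊢
        linarith
    _ = ((α * ∑ i, ∫ x in Set.Icc (0:V3) 1, lap (w i) x * w i x) - 0 - β * 0)
          + (K / 2 * (W * (∫ x in Set.Icc (0:V3) 1, ∑ i, ∑ j, (a i j x) ^ 2) + 3 * W)
            + β * (3 * K / 2) * (3 * N + W)) := by
        have h0 : ∫ x in Set.Icc (0:V3) 1, ∑ i, (∑ j, v j x * pd j (w i) x) * w i x = 0 := by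
          rw [integral_finsetSum _ fun i _ => Continuous.integrableOn_Icc (by fun_prop)]
          simp [htr]
        rw [integral_add (Continuous.integrableOn_Icc (by fun_prop))
            (Continuous.integrableOn_Icc (by fun_prop)),
          integral_sub (Continuous.integrableOn_Icc (by fun_prop))
            (Continuous.integrableOn_Icc (by fun_prop)),
          integral_sub (Continuous.integrableOn_Icc (by fun_prop))
            (Continuous.integrableOn_Icc (by fun_prop)),
          integral_add (Continuous.integrableOn_Icc (by fun_prop))
            (Continuous.integrableOn_Icc (by fun_prop)),
          integral_const_mul, integral_const_mul, integral_const_mul, integral_const_mul,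
          integral_add (Continuous.integrableOn_Icc (by fun_prop))
            (Continuous.integrableOn_Icc (by fun_prop)),
          integral_add (Continuous.integrableOn_Icc (by fun_prop))
            (Continuous.integrableOn_Icc (by fun_prop)),
          integral_const_mul, integral_const_mul, h0, hpr, hW,
          integral_finsetSum _ fun i _ => Continuous.integrableOn_Icc (by fun_prop)]
        simp [volume_real_cube]
    _ ≤ _ := by
        have h₁ : α * ∑ i, ∫ x in Set.Icc (0:V3) 1, lap (w i) x * w i x ≤ 0 :=
          mul_nonpos_of_nonneg_of_nonpos hα (Finset.sum_nonpos fun i _ => hlap i)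
        have h₂ : K / 2 * (W * ∫ x in Set.Icc (0:V3) 1, ∑ i, ∑ j, (a i j x) ^ 2)
            ≤ K / 2 * (W * P) := by gcongr
        linarith

lemma stress_energy_le {ε γ K P W N : ℝ} (hε : 0 ≤ ε) (hγ : 0 ≤ γ) (hK : 0 ≤ K) (hP : 0 ≤ P)
    (hW : 0 ≤ W) {τ S : Fin 3 → Fin 3 → V3 → ℝ} {v b : Fin 3 → V3 → ℝ}
    {G H : Fin 3 → Fin 3 → V3 → ℝ}
    (hτ : ∀ i j, SmoothPeriodic (τ i j)) (hS : ∀ i j, SmoothPeriodic (S i j))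
    (hv : ∀ i, SmoothPeriodic (v i)) (hvdiv : ∀ x, ∑ i, pd i (v i) x = 0)
    (hSP : ∫ x in Set.Icc (0:V3) 1, ∑ i, ∑ j, (S i j x) ^ 2 ≤ P)
    (hdSP : ∫ x in Set.Icc (0:V3) 1, ∑ i, ∑ j, ∑ k, (pd k (S i j) x) ^ 2 ≤ P)
    (hN : ∫ x in Set.Icc (0:V3) 1, ∑ i, ∑ j, (τ i j x) ^ 2 = N)
    (hb : ∀ j x, |b j x| ≤ K * √W) (hG : ∀ i k x, |G i k x| ≤ K * √P)
    (hH : ∀ i k x, |H i k x| ≤ K * √W) (hbc : ∀ j, Continuous (b j))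
    (hGc : ∀ i j, Continuous (G i j)) (hHc : ∀ i j, Continuous (H i j)) :
    ∫ x in Set.Icc (0:V3) 1, ∑ i, ∑ j, τ i j x * (ε * lap (fun y => S i j y + τ i j y) x
        - (∑ k, v k x * pd k (τ i j) x) - (∑ k, b k x * pd k (S i j) x)
        + (∑ k, (G i k x * τ k j x + H i k x * S k j x))
        + (∑ k, (τ i k x * G j k x + S i k x * H j k x)) - γ * τ i j x)
      ≤ ε * (P / 4) + K / 2 * (P * W + 3 * N) + K * (3 * P * N + 3 * N)
        + K * (3 * P * W + 3 * N) := by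
  have cτ : ∀ i j, Continuous (τ i j) := fun i j => (hτ i j).continuous
  have cS : ∀ i j, Continuous (S i j) := fun i j => (hS i j).continuous
  have cv : ∀ i, Continuous (v i) := fun i => (hv i).continuous
  have cpτ : ∀ i j k, Continuous (pd k (τ i j)) := fun i j k => (hτ i j).continuous_pd k
  have cpS : ∀ i j k, Continuous (pd k (S i j)) := fun i j k => (hS i j).continuous_pd k
  have clτ : ∀ i j, Continuous (lap fun y => S i j y + τ i j y) :=
    fun i j => ((hS i j).add (hτ i j)).continuous_lap
  have hlap : ∀ i j, ∫ x in Set.Icc (0:V3) 1, lap (fun y => S i j y + τ i j y) x * τ i j x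
      ≤ 1 / 4 * ∫ x in Set.Icc (0:V3) 1, ∑ k, (pd k (S i j) x) ^ 2 := fun i j => by
    rw [integral_lap_mul ((hS i j).add (hτ i j)) (hτ i j), ← integral_neg, ← integral_const_mul]
    simp only [pd_add (hS i j).differentiable (hτ i j).differentiable]
    refine integral_mono (Continuous.integrableOn_Icc (by fun_prop))
      (Continuous.integrableOn_Icc (by fun_prop)) fun x => ?_
    simp only [Fin.sum_univ_three]
    nlinarith [sq_nonneg (pd 0 (S i j) x + 2 * pd 0 (τ i j) x),
      sq_nonneg (pd 1 (S i j) x + 2 * pd 1 (τ i j) x),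
      sq_nonneg (pd 2 (S i j) x + 2 * pd 2 (τ i j) x)]
  have htr : ∀ i j, ∫ x in Set.Icc (0:V3) 1, (∑ k, v k x * pd k (τ i j) x) * τ i j x = 0 :=
    fun i j => integral_transport hv hvdiv (hτ i j)
  calc _ ≤ ∫ x in Set.Icc (0:V3) 1, ((ε * ∑ i, ∑ j, lap (fun y => S i j y + τ i j y) x * τ i j x)
          - ∑ i, ∑ j, (∑ k, v k x * pd k (τ i j) x) * τ i j x)
          + ((K / 2 * W) * (∑ i, ∑ j, ∑ k, (pd k (S i j) x) ^ 2)
            + (3 * K * W) * (∑ i, ∑ j, (S i j x) ^ 2)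
            + (3 * K / 2 + 3 * K * P + 3 * K + 3 * K) * ∑ i, ∑ j, (τ i j x) ^ 2) := by
        refine integral_mono (Continuous.integrableOn_Icc (by fun_prop))
          (Continuous.integrableOn_Icc (by fun_prop)) fun x => ?_
        have h₁ : ∀ i j k, τ i j x * -(b k x * pd k (S i j) x)
            ≤ K / 2 * (W * (pd k (S i j) x) ^ 2 + (τ i j x) ^ 2) := fun i j k => by
          have := neg_le_of_abs_le (abs_mul_mul_le_of_abs_le (r := pd k (S i j) x)
            (s := τ i j x) hK hW (hb k x))
          linarith
        have h₂ : ∀ i j k, τ i j x * (G i k x * τ k j x + H i k x * S k j x)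
            ≤ K / 2 * (P * (τ k j x) ^ 2 + (τ i j x) ^ 2)
              + K / 2 * (W * (S k j x) ^ 2 + (τ i j x) ^ 2) := fun i j k => by
          have h := le_of_abs_le (abs_mul_mul_le_of_abs_le (r := τ k j x)
            (s := τ i j x) hK hP (hG i k x))
          have h' := le_of_abs_le (abs_mul_mul_le_of_abs_le (r := S k j x)
            (s := τ i j x) hK hW (hH i k x))
          linarith
        have h₃ : ∀ i j k, τ i j x * (τ i k x * G j k x + S i k x * H j k x)
            ≤ K / 2 * (P * (τ i k x) ^ 2 + (τ i j x) ^ 2)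
              + K / 2 * (W * (S i k x) ^ 2 + (τ i j x) ^ 2) := fun i j k => by
          have h := le_of_abs_le (abs_mul_mul_le_of_abs_le (r := τ i k x)
            (s := τ i j x) hK hP (hG j k x))
          have h' := le_of_abs_le (abs_mul_mul_le_of_abs_le (r := S i k x)
            (s := τ i j x) hK hW (hH j k x))
          linarith
        have h₄ : 0 ≤ γ * ∑ i, ∑ j, (τ i j x) ^ 2 := by positivity
        have h₅ := Finset.sum_le_sum fun i (_ : i ∈ Finset.univ) =>
          Finset.sum_le_sum fun j (_ : j ∈ Finset.univ) =>
          Finset.sum_le_sum fun k (_ : k ∈ Finset.univ) =>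
            add_le_add (add_le_add (h₁ i j k) (h₂ i j k)) (h₃ i j k)
        clear h₁ h₂ h₃
        simp only [Fin.sum_univ_three] at h₄ h₅ ⊢
        linarith
    _ = ((ε * ∑ i, ∑ j, ∫ x in Set.Icc (0:V3) 1,
            lap (fun y => S i j y + τ i j y) x * τ i j x) - 0)
          + ((K / 2 * W) * (∫ x in Set.Icc (0:V3) 1, ∑ i, ∑ j, ∑ k, (pd k (S i j) x) ^ 2)
            + (3 * K * W) * (∫ x in Set.Icc (0:V3) 1, ∑ i, ∑ j, (S i j x) ^ 2)
            + (3 * K / 2 + 3 * K * P + 3 * K + 3 * K) * N) := by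
        have h0 : ∫ x in Set.Icc (0:V3) 1,
            ∑ i, ∑ j, (∑ k, v k x * pd k (τ i j) x) * τ i j x = 0 := by
          rw [integral_finsetSum _ fun i _ => Continuous.integrableOn_Icc (by fun_prop)]
          refine Finset.sum_eq_zero fun i _ => ?_
          rw [integral_finsetSum _ fun j _ => Continuous.integrableOn_Icc (by fun_prop)]
          simp [htr]
        have h₁ : ∫ x in Set.Icc (0:V3) 1,
            ∑ i, ∑ j, lap (fun y => S i j y + τ i j y) x * τ i j x
            = ∑ i, ∑ j, ∫ x in Set.Icc (0:V3) 1,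
              lap (fun y => S i j y + τ i j y) x * τ i j x := by
          rw [integral_finsetSum _ fun i _ => Continuous.integrableOn_Icc (by fun_prop)]
          refine Finset.sum_congr rfl fun i _ => ?_
          rw [integral_finsetSum _ fun j _ => Continuous.integrableOn_Icc (by fun_prop)]
        rw [integral_add (Continuous.integrableOn_Icc (by fun_prop))
            (Continuous.integrableOn_Icc (by fun_prop)),
          integral_sub (Continuous.integrableOn_Icc (by fun_prop))
            (Continuous.integrableOn_Icc (by fun_prop)),
          integral_add (Continuous.integrableOn_Icc (by fun_prop))
            (Continuous.integrableOn_Icc (by fun_prop)),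
          integral_add (Continuous.integrableOn_Icc (by fun_prop))
            (Continuous.integrableOn_Icc (by fun_prop)),
          integral_const_mul, integral_const_mul, integral_const_mul, integral_const_mul,
          h0, h₁, hN]
    _ ≤ _ := by
        have h₁ : ∑ i, ∑ j, ∫ x in Set.Icc (0:V3) 1, lap (fun y => S i j y + τ i j y) x * τ i j x
            ≤ P / 4 := by
          refine (Finset.sum_le_sum fun i _ => Finset.sum_le_sum fun j _ => hlap i j).trans ?_
          simp only [← Finset.mul_sum]
          have : ∑ i, ∑ j, ∫ x in Set.Icc (0:V3) 1, ∑ k, (pd k (S i j) x) ^ 2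
              = ∫ x in Set.Icc (0:V3) 1, ∑ i, ∑ j, ∑ k, (pd k (S i j) x) ^ 2 := by
            rw [integral_finsetSum _ fun i _ => Continuous.integrableOn_Icc (by fun_prop)]
            refine Finset.sum_congr rfl fun i _ => ?_
            rw [integral_finsetSum _ fun j _ => Continuous.integrableOn_Icc (by fun_prop)]
          rw [this]
          linarith
        have h₂ := mul_le_mul_of_nonneg_left h₁ hε
        have h₃ := mul_le_mul_of_nonneg_left hdSP (show 0 ≤ K / 2 * W by positivity)
        have h₄ := mul_le_mul_of_nonneg_left hSP (show 0 ≤ 3 * K * W by positivity)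
        linarith

lemma lap_sub {f g : V3 → ℝ} (hf : SmoothPeriodic f) (hg : SmoothPeriodic g) (x : V3) :
    lap (fun y => f y - g y) x = lap f x - lap g x := by
  have h : ∀ i, pd i (fun y => f y - g y) = fun y => pd i f y - pd i g y := fun i =>
    funext fun y => pd_sub hf.differentiable hg.differentiable i y
  simp only [lap, h, pd_sub (hf.pd _).differentiable (hg.pd _).differentiable,
    Finset.sum_sub_distrib]

lemma pd_J3_sub {η f g : V3 → ℝ} (hη : ContDiff ℝ (⊤:ℕ∞) η) (hs : HasCompactSupport η)
    (hf : SmoothPeriodic f) (hg : SmoothPeriodic g) (i : Fin 3) (x : V3) :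
    pd i (J3 η (fun y => f y - g y)) x = pd i (J3 η f) x - pd i (J3 η g) x := by
  have h : J3 η (fun y => f y - g y) = fun y => J3 η f y - J3 η g y := funext fun y =>
    J3_sub hη.continuous hs hf.continuous hg.continuous y
  rw [h, pd_sub (hf.mollify hη hs).differentiable (hg.mollify hη hs).differentiable]

lemma sum_pd_J3_eq_zero {η : V3 → ℝ} {v : Fin 3 → V3 → ℝ} (hη : ContDiff ℝ (⊤:ℕ∞) η)
    (hs : HasCompactSupport η) (hv : ∀ i, SmoothPeriodic (v i))
    (hdiv : ∀ x, ∑ i, pd i (v i) x = 0) (x : V3) : ∑ i, pd i (J3 η (v i)) x = 0 := by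
  simp only [pd_J3 hη hs (hv _).smooth]
  rw [← J3_sum hη.continuous hs fun i => (hv i).continuous_pd i]
  simp [hdiv, J3]

lemma abs_J3_le {η f : V3 → ℝ} {K M x : _} (hK : 0 ≤ K)
    (h : |J3 η f x| + √(∑ i, (pd i (J3 η f) x) ^ 2)
      ≤ K * √(∫ y in Set.Icc (0:V3) 1, (f y) ^ 2))
    (hM : ∫ y in Set.Icc (0:V3) 1, (f y) ^ 2 ≤ M) : |J3 η f x| ≤ K * √M := by
  have h₁ := Real.sqrt_nonneg (∑ i, (pd i (J3 η f) x) ^ 2)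
  have h₂ := mul_le_mul_of_nonneg_left (Real.sqrt_le_sqrt hM) hK
  linarith

lemma abs_pd_J3_le {η f : V3 → ℝ} {K M x : _} (hK : 0 ≤ K)
    (h : |J3 η f x| + √(∑ i, (pd i (J3 η f) x) ^ 2)
      ≤ K * √(∫ y in Set.Icc (0:V3) 1, (f y) ^ 2))
    (hM : ∫ y in Set.Icc (0:V3) 1, (f y) ^ 2 ≤ M) (i : Fin 3) :
    |pd i (J3 η f) x| ≤ K * √M := by
  have h₁ : |pd i (J3 η f) x| ≤ √(∑ i, (pd i (J3 η f) x) ^ 2) := by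
    rw [← Real.sqrt_sq_eq_abs]
    exact Real.sqrt_le_sqrt (Finset.single_le_sum (f := fun i => (pd i (J3 η f) x) ^ 2)
      (fun i _ => sq_nonneg _) (Finset.mem_univ i))
  have h₂ := mul_le_mul_of_nonneg_left (Real.sqrt_le_sqrt hM) hK
  have h₃ := abs_nonneg (J3 η f x)
  linarith

lemma SmoothPeriodic.of_joint {g : V3 × ℝ → ℝ} {t : ℝ} (hg : ContDiff ℝ (⊤:ℕ∞) g)
    (hp : Periodic3 fun x => g (x, t)) : SmoothPeriodic fun x => g (x, t) :=
  ⟨hg.comp (contDiff_id.prodMk contDiff_const), hp⟩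

/-- The energy of the difference of two solutions. -/
def diffEnergy (u v : V3 → ℝ → V3) (σ ρ : V3 → ℝ → Matrix (Fin 3) (Fin 3) ℝ) (t : ℝ) : ℝ :=
  (∫ x in Set.Icc (0:V3) 1, ∑ i, (u x t i - v x t i) ^ 2)
    + (∫ x in Set.Icc (0:V3) 1, ∑ i, ∑ j, (σ x t i j - ρ x t i j) ^ 2)

lemma exists_hasDerivAt_diffEnergy_le {α β γ δ ε K P T t : ℝ} {η : V3 → ℝ}
    {Fo uε u : V3 → ℝ → V3} {σε σ : V3 → ℝ → Matrix (Fin 3) (Fin 3) ℝ} {pε p : V3 → ℝ → ℝ}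
    (hα : 0 ≤ α) (hβ : 0 ≤ β) (hγ : 0 ≤ γ) (hε : 0 ≤ ε) (hK : 0 ≤ K) (hP : 0 ≤ P) (hT : 0 < T)
    (hη : ContDiff ℝ (⊤:ℕ∞) η) (hs : HasCompactSupport η)
    (hsolε : IsOBSolution η α β γ δ ε T Fo uε σε pε)
    (hsol : IsOBSolution η α β γ δ 0 T Fo u σ p)
    (hdivε : ∀ x, ∑ i, pd i (fun y => uε y t i) x = 0)
    (hdiv : ∀ x, ∑ i, pd i (fun y => u y t i) x = 0)
    (hJ : ∀ f : V3 → ℝ, Continuous f → Periodic3 f → ∀ x : V3,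
      |J3 η f x| + √(∑ i, (pd i (J3 η f) x) ^ 2)
        ≤ K * √(∫ y in Set.Icc (0:V3) 1, (f y) ^ 2))
    (huP : ∫ x in Set.Icc (0:V3) 1, ∑ i, ∑ j, (pd j (fun y => uε y t i) x) ^ 2 ≤ P)
    (hσP : ∫ x in Set.Icc (0:V3) 1, ∑ i, ∑ j, (σ x t i j) ^ 2 ≤ P)
    (hdσP : ∫ x in Set.Icc (0:V3) 1, ∑ i, ∑ j, ∑ k, (pd k (fun y => σ y t i j) x) ^ 2 ≤ P)
    (ht : t ∈ Set.Icc (0:ℝ) T) :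
    ∃ y', HasDerivAt (diffEnergy uε u σε σ) y' t ∧
      y' ≤ (9 * β * K + 15 * K + 14 * K * P) * diffEnergy uε u σε σ t + ε * (P / 2) := by
  obtain ⟨cuε, cσε, cpε, puε, pσε, ppε, eqε, seqε⟩ := hsolε
  obtain ⟨cu, cσ, cp, pu, pσ, pp, eq, seq⟩ := hsol
  have suε : ∀ i, SmoothPeriodic fun x => uε x t i := fun i => .of_joint (cuε i) (puε t i)
  have su : ∀ i, SmoothPeriodic fun x => u x t i := fun i => .of_joint (cu i) (pu t i)
  have sσε : ∀ i j, SmoothPeriodic fun x => σε x t i j := fun i j =>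
    .of_joint (cσε i j) (pσε t i j)
  have sσ : ∀ i j, SmoothPeriodic fun x => σ x t i j := fun i j => .of_joint (cσ i j) (pσ t i j)
  have spε : SmoothPeriodic fun x => pε x t := .of_joint cpε (ppε t)
  have sp : SmoothPeriodic fun x => p x t := .of_joint cp (pp t)
  have sw : ∀ i, SmoothPeriodic fun x => uε x t i - u x t i := fun i => (suε i).sub (su i)
  have sτ : ∀ i j, SmoothPeriodic fun x => σε x t i j - σ x t i j := fun i j =>
    (sσε i j).sub (sσ i j)
  have hwdiv : ∀ x, ∑ i, pd i (fun x => uε x t i - u x t i) x = 0 := fun x => by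
    simp only [pd_sub (suε _).differentiable (su _).differentiable, Finset.sum_sub_distrib,
      hdivε, hdiv, sub_zero]
  have cduε : ∀ i j, Continuous (pd j fun y => uε y t i) := fun i j => (suε i).continuous_pd j
  have cw : ∀ i, Continuous fun x => uε x t i - u x t i := fun i => (sw i).continuous
  have cτ : ∀ i j, Continuous fun x => σε x t i j - σ x t i j := fun i j => (sτ i j).continuous
  set W := ∫ x in Set.Icc (0:V3) 1, ∑ i, (uε x t i - u x t i) ^ 2
  set N := ∫ x in Set.Icc (0:V3) 1, ∑ i, ∑ j, (σε x t i j - σ x t i j) ^ 2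
  have hW0 : 0 ≤ W := by positivity
  have hN0 : 0 ≤ N := by positivity
  have wW : ∀ i, ∫ x in Set.Icc (0:V3) 1, (uε x t i - u x t i) ^ 2 ≤ W := fun i =>
    integral_mono (Continuous.integrableOn_Icc (by fun_prop))
      (Continuous.integrableOn_Icc (by fun_prop)) fun x =>
        Finset.single_le_sum (f := fun i => (uε x t i - u x t i) ^ 2)
          (fun i _ => sq_nonneg _) (Finset.mem_univ i)
  have τN : ∀ i j, ∫ x in Set.Icc (0:V3) 1, (σε x t i j - σ x t i j) ^ 2 ≤ N := fun i j =>
    integral_mono (Continuous.integrableOn_Icc (by fun_prop))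
      (Continuous.integrableOn_Icc (by fun_prop)) fun x =>
        (Finset.single_le_sum (f := fun j => (σε x t i j - σ x t i j) ^ 2)
          (fun i _ => sq_nonneg _) (Finset.mem_univ j)).trans
        (Finset.single_le_sum (f := fun i => ∑ j, (σε x t i j - σ x t i j) ^ 2)
          (fun i _ => by positivity) (Finset.mem_univ i))
  have dP : ∀ i j, ∫ x in Set.Icc (0:V3) 1, (pd j (fun y => uε y t i) x) ^ 2 ≤ P := fun i j =>
    (integral_mono (Continuous.integrableOn_Icc (by fun_prop))
      (Continuous.integrableOn_Icc (by fun_prop)) fun x =>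
        (Finset.single_le_sum (f := fun j => (pd j (fun y => uε y t i) x) ^ 2)
          (fun i _ => sq_nonneg _) (Finset.mem_univ j)).trans
        (Finset.single_le_sum (f := fun i => ∑ j, (pd j (fun y => uε y t i) x) ^ 2)
          (fun i _ => by positivity) (Finset.mem_univ i))).trans huP
  have bJw : ∀ i x, |J3 η (fun y => uε y t i - u y t i) x| ≤ K * √W := fun i x =>
    abs_J3_le hK (hJ _ (sw i).continuous (sw i).periodic x) (wW i)
  have bdJw : ∀ i k x, |pd k (J3 η (fun y => uε y t i - u y t i)) x| ≤ K * √W := fun i k x =>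
    abs_pd_J3_le hK (hJ _ (sw i).continuous (sw i).periodic x) (wW i) k
  have bdJu : ∀ i k x, |pd k (J3 η (fun y => uε y t i)) x| ≤ K * √P := fun i k x => by
    rw [pd_J3 hη hs (suε i).smooth]
    exact abs_J3_le hK (hJ _ ((suε i).continuous_pd k) ((suε i).pd k).periodic x) (dP i k)
  have bdJτ : ∀ i x, |∑ j, pd j (J3 η (fun y => σε y t i j - σ y t i j)) x| ≤ 3 * K * √N :=
    fun i x => by
      have h := fun j => abs_pd_J3_le hK (hJ _ (sτ i j).continuous (sτ i j).periodic x) (τN i j) j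
      refine (Finset.abs_sum_le_sum_abs _ _).trans ((Finset.sum_le_sum fun j _ => h j).trans ?_)
      simp [mul_assoc]
  have hvel := velocity_energy_le (α := α) (β := β) (K := K) (P := P) (W := W) (N := N) hα hβ hK hN0
    (w := fun i x => uε x t i - u x t i) (v := fun j => J3 η fun z => u z t j)
    (b := fun j => J3 η fun y => uε y t j - u y t j)
    (s := fun i x => ∑ j, pd j (J3 η (fun y => σε y t i j - σ y t i j)) x)
    (q := fun x => pε x t - p x t) (a := fun i j => pd j fun y => uε y t i)
    sw hwdiv (fun j => (su j).mollify hη hs) (sum_pd_J3_eq_zero hη hs su hdiv) (spε.sub sp) cduε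
    huP rfl bJw bdJτ (fun j => ((sw j).mollify hη hs).continuous)
    (fun i => continuous_finsetSum _ fun j _ => ((sτ i j).mollify hη hs).continuous_pd j)
  have hstr := stress_energy_le (ε := ε) (γ := γ) (K := K) (P := P) (W := W) (N := N) hε hγ hK hP hW0
    (τ := fun i j x => σε x t i j - σ x t i j) (S := fun i j x => σ x t i j)
    (v := fun j => J3 η fun z => uε z t j) (b := fun j => J3 η fun y => uε y t j - u y t j)
    (G := fun i k => pd k (J3 η fun y => uε y t i))
    (H := fun i k => pd k (J3 η fun y => uε y t i - u y t i))
    sτ sσ (fun j => (suε j).mollify hη hs) (sum_pd_J3_eq_zero hη hs suε hdivε) hσP hdσP rfl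
    bJw bdJu bdJw (fun j => ((sw j).mollify hη hs).continuous)
    (fun i k => ((suε i).mollify hη hs).continuous_pd k)
    (fun i k => ((sw i).mollify hη hs).continuous_pd k)
  have hud : UniqueDiffWithinAt ℝ (Set.Icc (0:ℝ) T) t := uniqueDiffOn_Icc hT t ht
  have g₁ : ContDiff ℝ (⊤:ℕ∞) fun q : V3 × ℝ => ∑ i, (uε q.1 q.2 i - u q.1 q.2 i) ^ 2 :=
    ContDiff.sum fun i _ => ((cuε i).sub (cu i)).pow 2
  have g₂ : ContDiff ℝ (⊤:ℕ∞) fun q : V3 × ℝ =>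
      ∑ i, ∑ j, (σε q.1 q.2 i j - σ q.1 q.2 i j) ^ 2 :=
    ContDiff.sum fun i _ => ContDiff.sum fun j _ => ((cσε i j).sub (cσ i j)).pow 2
  have d₁ := hasDerivAt_integral_cube g₁ t
  have d₂ := hasDerivAt_integral_cube g₂ t
  refine ⟨_, d₁.add d₂, ?_⟩
  have dif : ∀ {g : V3 × ℝ → ℝ}, ContDiff ℝ (⊤:ℕ∞) g → ∀ x,
      DifferentiableAt ℝ (fun s => g (x, s)) t := fun hg x =>
    ((hg.comp (contDiff_const.prodMk contDiff_id)).differentiable (by simp)) t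
  have e₁ : ∀ x, deriv (fun s => ∑ i, (uε x s i - u x s i) ^ 2) t
      = 2 * ∑ i, (uε x t i - u x t i) * (α * lap (fun x => uε x t i - u x t i) x
        - (∑ j, J3 η (fun z => u z t j) x * pd j (fun x => uε x t i - u x t i) x)
        - (∑ j, J3 η (fun y => uε y t j - u y t j) x * pd j (fun y => uε y t i) x)
        + β * (∑ j, pd j (J3 η (fun y => σε y t i j - σ y t i j)) x)
        - β * pd i (fun x => pε x t - p x t) x) := fun x => by
    have h := HasDerivWithinAt.fun_sum (u := Finset.univ) fun i _ =>
      ((eqε x t ht i).sub (eq x t ht i)).pow 2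
    rw [hud.eq_deriv _ (dif g₁ x).hasDerivAt.hasDerivWithinAt h, Finset.mul_sum]
    refine Finset.sum_congr rfl fun i _ => ?_
    simp only [lap_sub (suε _) (su _), pd_sub (suε _).differentiable (su _).differentiable,
      pd_sub spε.differentiable sp.differentiable,
      J3_sub hη.continuous hs (suε _).continuous (su _).continuous,
      pd_J3_sub hη hs (sσε _ _) (sσ _ _), Fin.sum_univ_three, Pi.sub_apply]
    push_cast
    ring
  have e₂ : ∀ x, deriv (fun s => ∑ i, ∑ j, (σε x s i j - σ x s i j) ^ 2) t
      = 2 * ∑ i, ∑ j, (σε x t i j - σ x t i j)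
        * (ε * lap (fun y => σ y t i j + (σε y t i j - σ y t i j)) x
        - (∑ k, J3 η (fun z => uε z t k) x * pd k (fun x => σε x t i j - σ x t i j) x)
        - (∑ k, J3 η (fun y => uε y t k - u y t k) x * pd k (fun x => σ x t i j) x)
        + (∑ k, (pd k (J3 η fun y => uε y t i) x * (σε x t k j - σ x t k j)
          + pd k (J3 η fun y => uε y t i - u y t i) x * σ x t k j))
        + (∑ k, ((σε x t i k - σ x t i k) * pd k (J3 η fun y => uε y t j) x
          + σ x t i k * pd k (J3 η fun y => uε y t j - u y t j) x))
        - γ * (σε x t i j - σ x t i j)) := fun x => by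
    have h := HasDerivWithinAt.fun_sum (u := Finset.univ) fun i _ =>
      HasDerivWithinAt.fun_sum (u := Finset.univ) fun j _ =>
      ((seqε x t ht i j).sub (seq x t ht i j)).pow 2
    rw [hud.eq_deriv _ (dif g₂ x).hasDerivAt.hasDerivWithinAt h, Finset.mul_sum]
    refine Finset.sum_congr rfl fun i _ => ?_
    rw [Finset.mul_sum]
    refine Finset.sum_congr rfl fun j _ => ?_
    simp only [add_sub_cancel, pd_sub (sσε _ _).differentiable (sσ _ _).differentiable,
      J3_sub hη.continuous hs (suε _).continuous (su _).continuous,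
      pd_J3_sub hη hs (suε _) (su _), Fin.sum_univ_three, Pi.sub_apply]
    push_cast
    ring
  simp only [e₁, e₂]
  rw [integral_const_mul, integral_const_mul]
  have hy : diffEnergy uε u σε σ t = W + N := rfl
  rw [hy]
  have := mul_nonneg (mul_nonneg hβ hK) hW0
  have := mul_nonneg hK hW0
  have := mul_nonneg (mul_nonneg hK hP) hW0
  have := mul_nonneg (mul_nonneg hK hP) hN0
  linarith

lemma le_mul_exp_sub_one_of_deriv_le {y : ℝ → ℝ} {A B T : ℝ} (hA : 0 < A) (hB : 0 ≤ B)
    (h0 : y 0 = 0)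
    (hy : ∀ t ∈ Set.Icc (0:ℝ) T, ∃ y', HasDerivAt y y' t ∧ y' ≤ A * y t + B)
    {t : ℝ} (ht : t ∈ Set.Icc (0:ℝ) T) : y t ≤ B / A * (Real.exp (A * T) - 1) := by
  have h := le_gronwallBound_of_liminf_deriv_right_le (f := y) (f' := deriv y) (δ := 0) (K := A)
    (ε := B) (a := 0) (b := T)
    (fun s hs => (hy s hs).choose_spec.1.continuousAt.continuousWithinAt)
    (fun s hs r hr => by
      obtain ⟨y', hd, -⟩ := hy s (Set.Ico_subset_Icc_self hs)
      rw [hd.deriv] at hr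
      exact hd.hasDerivWithinAt.liminf_right_slope_le hr)
    h0.le (fun s hs => by
      obtain ⟨y', hd, hle⟩ := hy s (Set.Ico_subset_Icc_self hs)
      rwa [hd.deriv]) t ht
  rw [gronwallBound_of_K_ne_0 hA.ne'] at h
  simp only [zero_mul, zero_add, sub_zero] at h
  refine h.trans ?_
  have := ht.2
  gcongr

/-- L² convergence of the diffusive solutions to the non-diffusive
one as ε → 0; the constant C depends only on β, γ, δ, K, P, E and T. -/
theorem L2_convergence_diffusive_to_nondiffusive (β γ δ K P E T : ℝ)
    (hβ : 0 < β) (hγ : 0 < γ) (hδ : 0 ≤ δ) (hK : 0 < K)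
    (hP : 0 < P) (hE : 0 < E) (hT : 0 < T) :
    ∃ C : ℝ, ∀ (α ε : ℝ), 0 < α → 0 < ε →
    ∀ (η : V3 → ℝ), ContDiff ℝ (⊤:ℕ∞) η → HasCompactSupport η →
      (∀ x : V3, η (-x) = η x) → (∫ x : V3, η x) = 1 →
    ∀ (Fo uε u : V3 → ℝ → V3) (σε σ : V3 → ℝ → Matrix (Fin 3) (Fin 3) ℝ)
      (pε p : V3 → ℝ → ℝ),
      IsOBSolution η α β γ δ ε T Fo uε σε pε →
      IsOBSolution η α β γ δ 0 T Fo u σ p →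
      -- same initial data
      (∀ x : V3, uε x 0 = u x 0) →
      (∀ x : V3, σε x 0 = σ x 0) →
      -- incompressibility
      (∀ (x : V3) (t : ℝ), (∑ i, pd i (fun y => uε y t i) x) = 0) →
      (∀ (x : V3) (t : ℝ), (∑ i, pd i (fun y => u y t i) x) = 0) →
      -- (i): mollification bound
      (∀ f : V3 → ℝ, Continuous f → Periodic3 f → ∀ x : V3,
        |J3 η f x| + Real.sqrt (∑ i, (pd i (J3 η f) x)^2)
          ≤ K * Real.sqrt (∫ y in Set.Icc (0:V3) 1, (f y)^2)) →
      -- (ii): time-integrated gradient bound for uε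
      ((∫ s in (0:ℝ)..T, ∫ x in Set.Icc (0:V3) 1, ∑ i, ∑ j,
          (pd j (fun y => uε y s i) x)^2) ≤ E) →
      -- (iii): uniform a priori bounds
      (∀ t ∈ Set.Icc (0:ℝ) T,
        (∫ x in Set.Icc (0:V3) 1, ∑ i, ∑ j, (pd j (fun y => uε y t i) x)^2) ≤ P ∧
        (∫ x in Set.Icc (0:V3) 1, ∑ i, ∑ j, (σ x t i j)^2) ≤ P ∧
        (∫ x in Set.Icc (0:V3) 1, ∑ i, ∑ j, ∑ k,
          (pd k (fun y => σ y t i j) x)^2) ≤ P ∧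
        (∫ x in Set.Icc (0:V3) 1, ∑ i, ∑ j, (lap (fun y => σ y t i j) x)^2) ≤ P) →
      ∀ t ∈ Set.Icc (0:ℝ) T,
        (∫ x in Set.Icc (0:V3) 1, ∑ i, (uε x t i - u x t i)^2)
          + (∫ x in Set.Icc (0:V3) 1, ∑ i, ∑ j, (σε x t i j - σ x t i j)^2)
        ≤ ε * C := by
  set A := 9 * β * K + 15 * K + 14 * K * P
  have hA0 : 0 < A := by positivity
  refine ⟨P / 2 / A * (Real.exp (A * T) - 1), ?_⟩
  intro α ε hα hε η hη hs _ _ Fo uε u σε σ pε p hsolε hsol hu0 hσ0 hdivε hdiv hJ _ hbd t ht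
  have h := le_mul_exp_sub_one_of_deriv_le (y := diffEnergy uε u σε σ) (B := ε * (P / 2)) hA0
    (by positivity) (by simp [diffEnergy, hu0, hσ0])
    (fun s hs' => exists_hasDerivAt_diffEnergy_le hα.le hβ.le hγ.le hε.le hK.le hP.le hT hη hs
      hsolε hsol (fun x => hdivε x s) (fun x => hdiv x s) hJ (hbd s hs').1 (hbd s hs').2.1
      (hbd s hs').2.2.1 hs') ht
  calc _ ≤ ε * (P / 2) / A * (Real.exp (A * T) - 1) := h
    _ = _ := by ring
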